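/- arXiv:2407.20386 — 2 statements merged into one kernel-verified Lean document; each statement's English description precedes it below -/
import Mathlib

section
/- Fix a real α with 0 < α < 1/2 and constants 0 < σ̲ ≤ σ̄ < ∞ and Δ̄ < ∞. For each N ≥ 1 let (Ω_N, Q_N) be a probability space carrying, for each label J ∈ {E, I}, real random variables L^J_N, U^J_N and almost surely positive random variables S^J_{l,N}, S^J_{u,N}; let θ_{l,N} ≤ θ_{u,N} be real parameters with θ_{u,N} − θ_{l,N} ≤ Δ̄; let σ^J_{l,N}, σ^J_{u,N} ∈ [σ̲, σ̄] and ρ^J_N ∈ [−1, 1]; and let θ_N ∈ ℝ with θ_N ∉ [θ_{l,N}, θ_{u,N}]. Assume: (i) Q_N(L^J_N ≤ U^J_N) = 1 for each J and N; (ii) σ^E_{l,N} ≤ σ^I_{l,N} and σ^E_{u,N} ≤ σ^I_{u,N} for all N; (iii) for each J, along every subsequence of indices along which (σ^J_{l,N}, σ^J_{u,N}, ρ^J_N) converges to some limit (σ_l, σ_u, ρ), the random vector √N·(L^J_N − θ_{l,N}, U^J_N − θ_{u,N}) converges in distribution to (σ_l Z₁, σ_u(ρ Z₁ + √(1−ρ²)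 Z₂)), where Z₁, Z₂ are independent standard normal random variables, and (S^J_{l,N}, S^J_{u,N}) converges in probability to (σ_l, σ_u). For each J and N, let C^J_N be the random variable defined pointwise as the unique c > 0 solving Φ(c + √N(U^J_N − L^J_N)/max{S^J_{l,N}, S^J_{u,N}}) − Φ(−c) = 1 − α, and let CI^J_N be the random interval [L^J_N − S^J_{l,N} C^J_N/√N, U^J_N + S^J_{u,N} C^J_N/√N]. Then liminf_{N→∞} ( Q_N(θ_N ∈ CI^E_N) − Q_N(θ_N ∈ CI^I_N) ) ≤ 0. -/
open MeasureTheory ProbabilityTheory Filter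

/-- The standard normal cumulative distribution function. -/
noncomputable def Phi (x : ℝ) : ℝ := (gaussianReal 0 1 (Set.Iic x)).toReal

/-- The joint law of `(σ_l Z₁, σ_u (ρ Z₁ + √(1−ρ²) Z₂))`, where `Z₁, Z₂` are
independent standard normal random variables. -/
noncomputable def limitLaw (sl su r : ℝ) : Measure (ℝ × ℝ) :=
  Measure.map (fun z : ℝ × ℝ => (sl * z.1, su * (r * z.1 + Real.sqrt (1 - r ^ 2) * z.2)))
    ((gaussianReal 0 1).prod (gaussianReal 0 1))

open Topology

lemma Phi_eq_cdf : Phi = cdf (gaussianReal 0 1) := funext fun x => (cdf_eq_real _ x).symm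

lemma hasDerivAt_Phi (x : ℝ) : HasDerivAt Phi (gaussianPDFReal 0 1 x) x := by
  have hint : Integrable (gaussianPDFReal 0 1) := integrable_gaussianPDFReal 0 1
  have hcont : Continuous (gaussianPDFReal 0 1) := by
    unfold gaussianPDFReal
    fun_prop
  have key : Phi = fun y => Phi 0 + ∫ t in (0 : ℝ)..y, gaussianPDFReal 0 1 t := by
    have h (y : ℝ) : Phi y = ∫ t in Set.Iic y, gaussianPDFReal 0 1 t := by
      rw [Phi, gaussianReal_apply_eq_integral 0 one_ne_zero, ENNReal.toReal_ofReal]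
      exact integral_nonneg fun t => gaussianPDFReal_nonneg 0 1 t
    funext y
    rw [← intervalIntegral.integral_Iic_sub_Iic hint.integrableOn hint.integrableOn, h y, h 0]
    ring
  rw [key]
  exact (intervalIntegral.integral_hasDerivAt_right (hcont.intervalIntegrable _ _)
    hcont.stronglyMeasurable.stronglyMeasurableAtFilter hcont.continuousAt).const_add _

lemma continuous_Phi : Continuous Phi :=
  continuous_iff_continuousAt.2 fun x => (hasDerivAt_Phi x).continuousAt

lemma strictMono_Phi : StrictMono Phi :=
  strictMono_of_hasDerivAt_pos hasDerivAt_Phi fun x => gaussianPDFReal_pos 0 1 x one_ne_zero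

lemma tendsto_Phi_atTop : Tendsto Phi atTop (𝓝 1) := by
  rw [Phi_eq_cdf]
  exact tendsto_cdf_atTop (gaussianReal 0 1)

lemma tendsto_Phi_atBot : Tendsto Phi atBot (𝓝 0) := by
  rw [Phi_eq_cdf]
  exact tendsto_cdf_atBot (gaussianReal 0 1)

lemma gaussianReal_noAtoms (x : ℝ) : gaussianReal 0 1 {x} = 0 :=
  have := nullSingletonClass_gaussianReal (μ := 0) (v := 1) one_ne_zero
  measure_singleton x

lemma gaussianReal_Iio_toReal (x : ℝ) : (gaussianReal 0 1 (Set.Iio x)).toReal = Phi x := by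
  have := nullSingletonClass_gaussianReal (μ := 0) (v := 1) one_ne_zero
  rw [Phi, measure_congr Iio_ae_eq_Iic]

lemma Phi_neg (x : ℝ) : Phi (-x) = 1 - Phi x := by
  have h : gaussianReal 0 1 (Set.Iic (-x)) = gaussianReal 0 1 (Set.Iio x)ᶜ := by
    conv_lhs => rw [← neg_zero, ← gaussianReal_map_neg]
    rw [Measure.map_apply measurable_neg measurableSet_Iic]
    congr 1
    ext y
    simp
  rw [Phi, h, ← gaussianReal_Iio_toReal]
  exact probReal_compl_eq_one_sub measurableSet_Iio

lemma Phi_zero : Phi 0 = 1 / 2 := by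
  have := Phi_neg 0
  rw [neg_zero] at this
  linarith

lemma Phi_lt_one (x : ℝ) : Phi x < 1 :=
  (strictMono_Phi (lt_add_one x)).trans_le
    (strictMono_Phi.monotone.ge_of_tendsto tendsto_Phi_atTop (x + 1))

lemma gaussianPDFReal_sub_eq_exp_mul (x t : ℝ) :
    gaussianPDFReal 0 1 (x - t) = Real.exp (x * t - t ^ 2 / 2) * gaussianPDFReal 0 1 x := by
  simp only [gaussianPDFReal, NNReal.coe_one, sub_zero, mul_one]
  rw [mul_left_comm, ← Real.exp_add]
  ring_nf

lemma mul_Phi_sub_le {a b t k : ℝ} (hab : a ≤ b)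
    (hk : ∀ x ∈ Set.Icc a b, k ≤ Real.exp (x * t - t ^ 2 / 2)) :
    k * (Phi b - Phi a) ≤ Phi (b - t) - Phi (a - t) := by
  have hd (x : ℝ) : HasDerivAt (fun x => Phi (x - t) - k * Phi x)
      (gaussianPDFReal 0 1 (x - t) - k * gaussianPDFReal 0 1 x) x := by
    simpa using ((hasDerivAt_Phi (x - t)).comp_sub_const x t).fun_sub
      ((hasDerivAt_Phi x).const_mul k)
  have hmono : MonotoneOn (fun x => Phi (x - t) - k * Phi x) (Set.Icc a b) := by
    refine monotoneOn_of_deriv_nonneg (convex_Icc a b)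
      (fun x _ => (hd x).continuousAt.continuousWithinAt)
      (fun x _ => (hd x).differentiableAt.differentiableWithinAt) fun x hx => ?_
    rw [(hd x).deriv, gaussianPDFReal_sub_eq_exp_mul, ← sub_mul]
    exact mul_nonneg (sub_nonneg.2 (hk x (interior_subset hx))) (gaussianPDFReal_nonneg 0 1 x)
  have := hmono (Set.left_mem_Icc.2 hab) (Set.right_mem_Icc.2 hab) hab
  simp only at this
  linarith

lemma Phi_sub_le_mul {a b t k : ℝ} (hab : a ≤ b)
    (hk : ∀ x ∈ Set.Icc a b, Real.exp (x * t - t ^ 2 / 2) ≤ k) :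
    Phi (b - t) - Phi (a - t) ≤ k * (Phi b - Phi a) := by
  have hd (x : ℝ) : HasDerivAt (fun x => k * Phi x - Phi (x - t))
      (k * gaussianPDFReal 0 1 x - gaussianPDFReal 0 1 (x - t)) x := by
    simpa using ((hasDerivAt_Phi x).const_mul k).fun_sub
      ((hasDerivAt_Phi (x - t)).comp_sub_const x t)
  have hmono : MonotoneOn (fun x => k * Phi x - Phi (x - t)) (Set.Icc a b) := by
    refine monotoneOn_of_deriv_nonneg (convex_Icc a b)
      (fun x _ => (hd x).continuousAt.continuousWithinAt)
      (fun x _ => (hd x).differentiableAt.differentiableWithinAt) fun x hx => ?_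
    rw [(hd x).deriv, gaussianPDFReal_sub_eq_exp_mul, ← sub_mul]
    exact mul_nonneg (sub_nonneg.2 (hk x (interior_subset hx))) (gaussianPDFReal_nonneg 0 1 x)
  have := hmono (Set.left_mem_Icc.2 hab) (Set.right_mem_Icc.2 hab) hab
  simp only at this
  linarith

lemma antitoneOn_Phi_sub_add_Phi_add {c e : ℝ} (hc : 0 ≤ c) (hce : c ≤ e) :
    AntitoneOn (fun s => Phi (c - s) + Phi (e + s)) (Set.Ici 0) := by
  have hd (s : ℝ) : HasDerivAt (fun s => Phi (c - s) + Phi (e + s))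
      (-gaussianPDFReal 0 1 (c - s) + gaussianPDFReal 0 1 (e + s)) s := by
    simpa using ((hasDerivAt_Phi (c - s)).comp_const_sub c s).fun_add
      ((hasDerivAt_Phi (e + s)).comp_const_add e s)
  refine antitoneOn_of_deriv_nonpos (convex_Ici 0)
    (fun x _ => (hd x).continuousAt.continuousWithinAt)
    (fun x _ => (hd x).differentiableAt.differentiableWithinAt) fun s hs => ?_
  have hs : 0 ≤ s := interior_subset hs
  rw [(hd s).deriv, neg_add_nonpos_iff]
  simp only [gaussianPDFReal, NNReal.coe_one, sub_zero, mul_one]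
  gcongr 1
  · rw [Real.exp_le_exp]
    have : (c - s) ^ 2 ≤ (e + s) ^ 2 := sq_le_sq' (by linarith) (by linarith)
    linarith

/-- Spreading a pair of arguments apart with constant `Phi c + Phi e` lowers the shifted sum. -/
lemma Phi_sub_add_Phi_add_le {c₁ e₁ c₂ e₂ s₁ s₂ : ℝ} (hc₂ : 0 ≤ c₂) (hc : c₂ ≤ c₁)
    (hce : c₁ ≤ e₁) (he : e₁ ≤ e₂) (hs₁ : 0 ≤ s₁) (hs : s₁ ≤ s₂)
    (heq : Phi c₁ + Phi e₁ = Phi c₂ + Phi e₂) :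
    Phi (c₂ - s₂) + Phi (e₂ + s₂) ≤ Phi (c₁ - s₁) + Phi (e₁ + s₁) := by
  have h₁ := antitoneOn_Phi_sub_add_Phi_add hc₂ (hc.trans (hce.trans he)) hs₁
    (hs₁.trans hs) hs
  simp only at h₁
  have h₂ := mul_Phi_sub_le (t := s₁) (k := Real.exp (c₂ * s₁ - s₁ ^ 2 / 2)) hc
    fun x hx => Real.exp_le_exp.2 (by nlinarith [hx.1])
  have h₃ := Phi_sub_le_mul (t := -s₁) (k := Real.exp (c₂ * s₁ - s₁ ^ 2 / 2)) he
    fun x hx => Real.exp_le_exp.2 (by nlinarith [hx.1])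
  simp only [sub_neg_eq_add] at h₃
  have h₄ : Phi e₂ - Phi e₁ = Phi c₁ - Phi c₂ := by linarith
  rw [h₄] at h₃
  linarith

lemma exists_critical_value {α : ℝ} (hα : 0 < α) (hα' : α < 1 / 2) (τ : ℝ) :
    ∃ c, 0 < c ∧ Phi (c + τ) - Phi (-c) = 1 - α := by
  have hcont : Continuous fun c => Phi (c + τ) - Phi (-c) := by
    have := continuous_Phi
    fun_prop
  have hlim : Tendsto (fun c => Phi (c + τ) - Phi (-c)) atTop (𝓝 (1 - 0)) :=
    (tendsto_Phi_atTop.comp (tendsto_atTop_add_const_right _ τ tendsto_id)).sub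
      (tendsto_Phi_atBot.comp tendsto_neg_atTop_atBot)
  obtain ⟨M, hM, hM0⟩ :=
    ((hlim.eventually (lt_mem_nhds (show 1 - α < 1 - 0 by linarith))).and
      (eventually_ge_atTop 0)).exists
  have h0 : Phi (0 + τ) - Phi (-0) < 1 - α := by
    rw [neg_zero, Phi_zero]
    linarith [Phi_lt_one (0 + τ)]
  obtain ⟨c, hc, hceq⟩ := intermediate_value_Icc hM0 hcont.continuousOn ⟨h0.le, hM.le⟩
  refine ⟨c, lt_of_le_of_ne hc.1 ?_, hceq⟩
  rintro rfl
  exact h0.ne hceq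

lemma exists_critical_value_top {α : ℝ} (hα : 0 < α) (hα' : α < 1 / 2) :
    ∃ c, 0 < c ∧ Phi c = 1 - α := by
  obtain ⟨M, hM, hM0⟩ :=
    ((tendsto_Phi_atTop.eventually (lt_mem_nhds (show 1 - α < 1 by linarith))).and
      (eventually_ge_atTop 0)).exists
  have h0 : Phi 0 < 1 - α := by
    rw [Phi_zero]
    linarith
  obtain ⟨c, hc, hceq⟩ := intermediate_value_Icc hM0 continuous_Phi.continuousOn ⟨h0.le, hM.le⟩
  refine ⟨c, lt_of_le_of_ne hc.1 ?_, hceq⟩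
  rintro rfl
  exact h0.ne hceq

lemma tendsto_critical_value {ι : Type*} {l : Filter ι} {α τ c : ℝ} {C T : ι → ℝ}
    (hT : Tendsto T l (𝓝 τ)) (hc : Phi (c + τ) - Phi (-c) = 1 - α)
    (hC : ∀ᶠ i in l, Phi (C i + T i) - Phi (-C i) = 1 - α) : Tendsto C l (𝓝 c) := by
  have hcont (b : ℝ) : Tendsto (fun i => Phi (b + T i) - Phi (-b)) l
      (𝓝 (Phi (b + τ) - Phi (-b))) :=
    ((continuous_Phi.tendsto _).comp (hT.const_add b)).sub_const _
  refine tendsto_order.2 ⟨fun b hb => ?_, fun b hb => ?_⟩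
  · have : Phi (b + τ) - Phi (-b) < 1 - α := by
      linarith [strictMono_Phi (add_lt_add_left hb τ), strictMono_Phi (neg_lt_neg hb)]
    filter_upwards [hC, (hcont b).eventually (gt_mem_nhds this)] with i hi hlt
    by_contra! hle
    linarith [strictMono_Phi.monotone (add_le_add_left hle (T i)),
      strictMono_Phi.monotone (neg_le_neg hle)]
  · have : 1 - α < Phi (b + τ) - Phi (-b) := by
      linarith [strictMono_Phi (add_lt_add_left hb τ), strictMono_Phi (neg_lt_neg hb)]
    filter_upwards [hC, (hcont b).eventually (lt_mem_nhds this)] with i hi hlt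
    by_contra! hle
    linarith [strictMono_Phi.monotone (add_le_add_left hle (T i)),
      strictMono_Phi.monotone (neg_le_neg hle)]

lemma tendsto_critical_value_top {ι : Type*} {l : Filter ι} {α c : ℝ} {C T : ι → ℝ}
    (hT : Tendsto T l atTop) (hc : Phi c = 1 - α)
    (hC : ∀ᶠ i in l, Phi (C i + T i) - Phi (-C i) = 1 - α) : Tendsto C l (𝓝 c) := by
  have hcont (b : ℝ) : Tendsto (fun i => Phi (b + T i) - Phi (-b)) l (𝓝 (1 - Phi (-b))) :=
    (tendsto_Phi_atTop.comp (tendsto_atTop_add_const_left l b hT)).sub_const _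
  refine tendsto_order.2 ⟨fun b hb => ?_, fun b hb => ?_⟩
  · have : 1 - Phi (-b) < 1 - α := by
      linarith [strictMono_Phi hb, Phi_neg b]
    filter_upwards [hC, (hcont b).eventually (gt_mem_nhds this)] with i hi hlt
    by_contra! hle
    linarith [strictMono_Phi.monotone (add_le_add_left hle (T i)),
      strictMono_Phi.monotone (neg_le_neg hle)]
  · have : 1 - α < 1 - Phi (-b) := by
      linarith [strictMono_Phi hb, Phi_neg b]
    filter_upwards [hC, (hcont b).eventually (lt_mem_nhds this)] with i hi hlt
    by_contra! hle
    linarith [strictMono_Phi.monotone (add_le_add_left hle (T i)),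
      strictMono_Phi.monotone (neg_le_neg hle)]

/-- Critical values decrease, and the far endpoints increase, with the interval width. -/
lemma critical_value_antitone {α c₁ d₁ c₂ d₂ : ℝ} (hd : d₁ ≤ d₂)
    (h₁ : Phi (c₁ + d₁) - Phi (-c₁) = 1 - α) (h₂ : Phi (c₂ + d₂) - Phi (-c₂) = 1 - α) :
    c₂ ≤ c₁ ∧ c₁ + d₁ ≤ c₂ + d₂ := by
  rw [Phi_neg] at h₁ h₂
  have hc : c₂ ≤ c₁ := by
    by_contra! h
    linarith [strictMono_Phi h, strictMono_Phi (show c₁ + d₁ < c₂ + d₂ by linarith)]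
  refine ⟨hc, ?_⟩
  by_contra! h
  linarith [strictMono_Phi h, strictMono_Phi.monotone hc]

section ProbabilityFilter

variable {Ω : ℕ → Type} [∀ k, MeasurableSpace (Ω k)]

/-- The filter of events whose probability tends to one along a sequence of probability spaces.
Convergence in probability of `f` to `a` is `Tendsto f (probFilter Q) (𝓝 a)`. -/
def probFilter (Q : ∀ k, Measure (Ω k)) [∀ k, IsProbabilityMeasure (Q k)] :
    Filter (Σ k, Ω k) where
  sets := {s | Tendsto (fun k => (Q k).real {ω | ⟨k, ω⟩ ∉ s}) atTop (𝓝 0)}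
  univ_sets := by simp
  sets_of_superset {s t} hs hst := by
    refine squeeze_zero (fun k => measureReal_nonneg) (fun k => ?_) hs
    exact measureReal_mono fun ω hω hmem => hω (hst hmem)
  inter_sets {s t} hs ht := by
    refine squeeze_zero (fun k => measureReal_nonneg) (fun k => ?_)
      (by simpa using Tendsto.add hs ht)
    refine (measureReal_mono fun ω hω => ?_).trans (measureReal_union_le _ _)
    exact not_and_or.1 hω

variable {Q : ∀ k, Measure (Ω k)} [∀ k, IsProbabilityMeasure (Q k)]

lemma eventually_probFilter {P : (Σ k, Ω k) → Prop} :
    (∀ᶠ p in probFilter Q, P p) ↔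
      Tendsto (fun k => (Q k).real {ω | ¬ P ⟨k, ω⟩}) atTop (𝓝 0) :=
  Iff.rfl

lemma eventually_probFilter_of_ae {P : (Σ k, Ω k) → Prop}
    (h : ∀ k, ∀ᵐ ω ∂(Q k), P ⟨k, ω⟩) : ∀ᶠ p in probFilter Q, P p := by
  rw [eventually_probFilter]
  refine tendsto_const_nhds.congr fun k => ?_
  rw [measureReal_def, ae_iff.1 (h k), ENNReal.toReal_zero]

lemma tendsto_fst_probFilter : Tendsto Sigma.fst (probFilter Q) atTop := by
  refine tendsto_atTop.2 fun n => eventually_probFilter.2 ?_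
  refine tendsto_const_nhds.congr' ?_
  filter_upwards [eventually_ge_atTop n] with k hk
  simp [hk]

variable {A : ℝ → Set (Σ k, Ω k)} {F : ℝ → ℝ} {a : (Σ k, Ω k) → ℝ}

lemma eventually_measureReal_lt (hA : Monotone A) {x v : ℝ}
    (hx : Tendsto (fun k => (Q k).real {ω | ⟨k, ω⟩ ∈ A x}) atTop (𝓝 (F x)))
    (ha : ∀ᶠ p in probFilter Q, a p ≤ x) (hv : F x < v) :
    ∀ᶠ k in atTop, (Q k).real {ω | ⟨k, ω⟩ ∈ A (a ⟨k, ω⟩)} < v := by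
  have hlim := hx.add (eventually_probFilter.1 ha)
  rw [add_zero] at hlim
  filter_upwards [hlim.eventually (gt_mem_nhds hv)] with k hk
  refine lt_of_le_of_lt ((measureReal_mono fun ω hω => ?_).trans (measureReal_union_le _ _)) hk
  by_cases h : a ⟨k, ω⟩ ≤ x
  · exact Or.inl (hA h hω)
  · exact Or.inr h

lemma eventually_lt_measureReal (hA : Monotone A) {x v : ℝ}
    (hx : Tendsto (fun k => (Q k).real {ω | ⟨k, ω⟩ ∈ A x}) atTop (𝓝 (F x)))
    (ha : ∀ᶠ p in probFilter Q, x ≤ a p) (hv : v < F x) :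
    ∀ᶠ k in atTop, v < (Q k).real {ω | ⟨k, ω⟩ ∈ A (a ⟨k, ω⟩)} := by
  have hlim := hx.sub (eventually_probFilter.1 ha)
  rw [sub_zero] at hlim
  filter_upwards [hlim.eventually (lt_mem_nhds hv)] with k hk
  refine lt_of_lt_of_le hk (sub_le_iff_le_add.2 ?_)
  refine (measureReal_mono fun ω hω => ?_).trans (measureReal_union_le _ _)
  by_cases h : x ≤ a ⟨k, ω⟩
  · exact Or.inl (hA h hω)
  · exact Or.inr h

/-- A form of Slutsky's theorem: deterministic thresholds in a limiting distribution function may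
be replaced by random ones converging in probability. -/
lemma tendsto_measureReal_of_tendsto_nhds (hA : Monotone A)
    (hF : ∀ x, Tendsto (fun k => (Q k).real {ω | ⟨k, ω⟩ ∈ A x}) atTop (𝓝 (F x)))
    (hcont : Continuous F) {a₀ : ℝ} (ha : Tendsto a (probFilter Q) (𝓝 a₀)) :
    Tendsto (fun k => (Q k).real {ω | ⟨k, ω⟩ ∈ A (a ⟨k, ω⟩)}) atTop (𝓝 (F a₀)) := by
  refine tendsto_order.2 ⟨fun v hv => ?_, fun v hv => ?_⟩
  · have h : ∀ᶠ x in 𝓝[<] a₀, v < F x :=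
      nhdsWithin_le_nhds (hcont.continuousAt.eventually (lt_mem_nhds hv))
    obtain ⟨x, hvx, hx⟩ := (h.and self_mem_nhdsWithin).exists
    exact eventually_lt_measureReal hA (hF x)
      ((ha.eventually (lt_mem_nhds hx)).mono fun _ => le_of_lt) hvx
  · have h : ∀ᶠ x in 𝓝[>] a₀, F x < v :=
      nhdsWithin_le_nhds (hcont.continuousAt.eventually (gt_mem_nhds hv))
    obtain ⟨x, hvx, hx⟩ := (h.and self_mem_nhdsWithin).exists
    exact eventually_measureReal_lt hA (hF x)
      ((ha.eventually (gt_mem_nhds hx)).mono fun _ => le_of_lt) hvx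

lemma tendsto_measureReal_of_tendsto_atBot (hA : Monotone A)
    (hF : ∀ x, Tendsto (fun k => (Q k).real {ω | ⟨k, ω⟩ ∈ A x}) atTop (𝓝 (F x)))
    (hbot : Tendsto F atBot (𝓝 0)) (ha : Tendsto a (probFilter Q) atBot) :
    Tendsto (fun k => (Q k).real {ω | ⟨k, ω⟩ ∈ A (a ⟨k, ω⟩)}) atTop (𝓝 0) := by
  refine Metric.tendsto_nhds.2 fun v hv => ?_
  have h : ∀ᶠ x in atBot, F x < v := hbot.eventually (gt_mem_nhds hv)
  obtain ⟨x, hx⟩ := h.exists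
  have hax : ∀ᶠ p in probFilter Q, a p ≤ x := tendsto_atBot.1 ha x
  filter_upwards [eventually_measureReal_lt hA (hF x) hax hx] with k hk
  rwa [Real.dist_0_eq_abs, abs_of_nonneg measureReal_nonneg]

/-- Rescaled bound estimators `X`, `W`, standard errors `Sl`, `Su` and critical values `C` along a
sequence with rescaled population width `δ` and limiting standard deviations `σl`, `σu`. -/
structure AsymptoticBounds (Q : ∀ k, Measure (Ω k)) [∀ k, IsProbabilityMeasure (Q k)] (α : ℝ)
    (X W Sl Su C : (Σ k, Ω k) → ℝ) (δ : ℕ → ℝ) (σl σu : ℝ) : Prop where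
  measurable_X : ∀ k, Measurable fun ω => X ⟨k, ω⟩
  measurable_W : ∀ k, Measurable fun ω => W ⟨k, ω⟩
  measurable_Sl : ∀ k, Measurable fun ω => Sl ⟨k, ω⟩
  measurable_Su : ∀ k, Measurable fun ω => Su ⟨k, ω⟩
  measurable_C : ∀ k, Measurable fun ω => C ⟨k, ω⟩
  σl_pos : 0 < σl
  σu_pos : 0 < σu
  tendsto_X : ∀ x, Tendsto (fun k => (Q k).real {ω | X ⟨k, ω⟩ ≤ x}) atTop (𝓝 (Phi (x / σl)))
  tendsto_W : ∀ x, Tendsto (fun k => (Q k).real {ω | W ⟨k, ω⟩ < x}) atTop (𝓝 (Phi (x / σu)))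
  tendsto_Sl : Tendsto Sl (probFilter Q) (𝓝 σl)
  tendsto_Su : Tendsto Su (probFilter Q) (𝓝 σu)
  S_pos : ∀ k, ∀ᵐ ω ∂(Q k), 0 < Sl ⟨k, ω⟩ ∧ 0 < Su ⟨k, ω⟩
  le : ∀ k, ∀ᵐ ω ∂(Q k), X ⟨k, ω⟩ ≤ W ⟨k, ω⟩ + δ k
  degenerate : ∀ d, Tendsto δ atTop (𝓝 d) →
    σl = σu ∧ Tendsto (fun p => W p - X p) (probFilter Q) (𝓝 0)
  critical : ∀ k, ∀ᵐ ω ∂(Q k), 0 < C ⟨k, ω⟩ ∧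
    Phi (C ⟨k, ω⟩ + (W ⟨k, ω⟩ - X ⟨k, ω⟩ + δ k) / max (Sl ⟨k, ω⟩) (Su ⟨k, ω⟩)) -
      Phi (-C ⟨k, ω⟩) = 1 - α

namespace AsymptoticBounds

variable {α : ℝ} {X W Sl Su C : (Σ k, Ω k) → ℝ} {δ : ℕ → ℝ} {σl σu : ℝ}

lemma reflect (H : AsymptoticBounds Q α X W Sl Su C δ σl σu) :
    AsymptoticBounds Q α (fun p => -W p) (fun p => -X p) Su Sl C δ σu σl where
  measurable_X k := (H.measurable_W k).neg
  measurable_W k := (H.measurable_X k).neg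
  measurable_Sl := H.measurable_Su
  measurable_Su := H.measurable_Sl
  measurable_C := H.measurable_C
  σl_pos := H.σu_pos
  σu_pos := H.σl_pos
  tendsto_X x := by
    have h := (H.tendsto_W (-x)).const_sub 1
    rw [neg_div, Phi_neg, sub_sub_cancel] at h
    refine h.congr fun k => ?_
    rw [← probReal_compl_eq_one_sub (measurableSet_lt (H.measurable_W k) measurable_const)]
    congr 1
    ext ω
    simp [neg_le]
  tendsto_W x := by
    have h := (H.tendsto_X (-x)).const_sub 1
    rw [neg_div, Phi_neg, sub_sub_cancel] at h
    refine h.congr fun k => ?_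
    rw [← probReal_compl_eq_one_sub (measurableSet_le (H.measurable_X k) measurable_const)]
    congr 1
    ext ω
    simp [neg_lt]
  tendsto_Sl := H.tendsto_Su
  tendsto_Su := H.tendsto_Sl
  S_pos k := (H.S_pos k).mono fun ω => And.symm
  le k := (H.le k).mono fun ω h => by linarith
  degenerate d hd := by
    refine ⟨(H.degenerate d hd).1.symm, (H.degenerate d hd).2.congr fun p => ?_⟩
    ring
  critical k := (H.critical k).mono fun ω h => by
    rw [max_comm, neg_sub_neg]
    exact h

lemma tendsto_measureReal_X_nhds (H : AsymptoticBounds Q α X W Sl Su C δ σl σu)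
    {a : (Σ k, Ω k) → ℝ} {a₀ : ℝ} (ha : Tendsto a (probFilter Q) (𝓝 a₀)) :
    Tendsto (fun k => (Q k).real {ω | X ⟨k, ω⟩ ≤ a ⟨k, ω⟩}) atTop (𝓝 (Phi (a₀ / σl))) :=
  tendsto_measureReal_of_tendsto_nhds (A := fun x => {p | X p ≤ x}) (F := fun x => Phi (x / σl))
    (fun _ _ hxy _ hp => le_trans hp hxy) H.tendsto_X
    (continuous_Phi.comp (continuous_id.div_const _)) ha

lemma tendsto_measureReal_W_nhds (H : AsymptoticBounds Q α X W Sl Su C δ σl σu)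
    {a : (Σ k, Ω k) → ℝ} {a₀ : ℝ} (ha : Tendsto a (probFilter Q) (𝓝 a₀)) :
    Tendsto (fun k => (Q k).real {ω | W ⟨k, ω⟩ < a ⟨k, ω⟩}) atTop (𝓝 (Phi (a₀ / σu))) :=
  tendsto_measureReal_of_tendsto_nhds (A := fun x => {p | W p < x}) (F := fun x => Phi (x / σu))
    (fun _ _ hxy _ hp => lt_of_lt_of_le hp hxy) H.tendsto_W
    (continuous_Phi.comp (continuous_id.div_const _)) ha

lemma tendsto_measureReal_X_atBot (H : AsymptoticBounds Q α X W Sl Su C δ σl σu)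
    {a : (Σ k, Ω k) → ℝ} (ha : Tendsto a (probFilter Q) atBot) :
    Tendsto (fun k => (Q k).real {ω | X ⟨k, ω⟩ ≤ a ⟨k, ω⟩}) atTop (𝓝 0) :=
  tendsto_measureReal_of_tendsto_atBot (A := fun x => {p | X p ≤ x})
    (F := fun x => Phi (x / σl)) (fun _ _ hxy _ hp => le_trans hp hxy) H.tendsto_X
    (tendsto_Phi_atBot.comp (tendsto_id.atBot_div_const H.σl_pos)) ha

lemma tendsto_measureReal_W_atBot (H : AsymptoticBounds Q α X W Sl Su C δ σl σu)
    {a : (Σ k, Ω k) → ℝ} (ha : Tendsto a (probFilter Q) atBot) :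
    Tendsto (fun k => (Q k).real {ω | W ⟨k, ω⟩ < a ⟨k, ω⟩}) atTop (𝓝 0) :=
  tendsto_measureReal_of_tendsto_atBot (A := fun x => {p | W p < x})
    (F := fun x => Phi (x / σu)) (fun _ _ hxy _ hp => lt_of_lt_of_le hp hxy) H.tendsto_W
    (tendsto_Phi_atBot.comp (tendsto_id.atBot_div_const H.σu_pos)) ha

lemma eventually_le_W (H : AsymptoticBounds Q α X W Sl Su C δ σl σu)
    {a : (Σ k, Ω k) → ℝ} (ha : Tendsto a (probFilter Q) atBot) :
    ∀ᶠ p in probFilter Q, a p ≤ W p := by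
  simpa only [eventually_probFilter, not_le] using H.tendsto_measureReal_W_atBot ha

lemma tendsto_width_atTop (H : AsymptoticBounds Q α X W Sl Su C δ σl σu)
    (hδ : Tendsto δ atTop atTop) :
    Tendsto (fun p => W p - X p + δ p.1) (probFilter Q) atTop := by
  have hδ' : Tendsto (fun p : Σ k, Ω k => δ p.1) (probFilter Q) atTop :=
    hδ.comp tendsto_fst_probFilter
  have ha : Tendsto (fun p : Σ k, Ω k => -(δ p.1 / 3)) (probFilter Q) atBot :=
    tendsto_neg_atTop_atBot.comp (hδ'.atTop_div_const (by norm_num))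
  refine tendsto_atTop_mono' _ ?_ (hδ'.atTop_div_const (show (0 : ℝ) < 3 by norm_num))
  filter_upwards [H.eventually_le_W ha, H.reflect.eventually_le_W ha] with p hW hX
  linarith

lemma tendsto_width_nhds (H : AsymptoticBounds Q α X W Sl Su C δ σl σu) {d : ℝ}
    (hδ : Tendsto δ atTop (𝓝 d)) :
    Tendsto (fun p => W p - X p + δ p.1) (probFilter Q) (𝓝 d) := by
  simpa using (H.degenerate d hδ).2.add (hδ.comp tendsto_fst_probFilter)

lemma tendsto_max (H : AsymptoticBounds Q α X W Sl Su C δ σl σu) :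
    Tendsto (fun p => max (Sl p) (Su p)) (probFilter Q) (𝓝 (max σl σu)) :=
  H.tendsto_Sl.max H.tendsto_Su

lemma tendsto_C_of_atTop (H : AsymptoticBounds Q α X W Sl Su C δ σl σu) {c : ℝ}
    (hδ : Tendsto δ atTop atTop) (hc : Phi c = 1 - α) :
    Tendsto C (probFilter Q) (𝓝 c) := by
  have hmax : 0 < max σl σu := H.σl_pos.trans_le (le_max_left _ _)
  refine tendsto_critical_value_top
    (T := fun p => (W p - X p + δ p.1) / max (Sl p) (Su p)) ?_ hc
    (eventually_probFilter_of_ae fun k => (H.critical k).mono fun ω => And.right)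
  exact (H.tendsto_width_atTop hδ).atTop_mul_pos (inv_pos.2 hmax) (H.tendsto_max.inv₀ hmax.ne')

lemma tendsto_C_of_nhds (H : AsymptoticBounds Q α X W Sl Su C δ σl σu) {d c : ℝ}
    (hδ : Tendsto δ atTop (𝓝 d)) (hc : Phi (c + d / σl) - Phi (-c) = 1 - α) :
    Tendsto C (probFilter Q) (𝓝 c) := by
  refine tendsto_critical_value
    (T := fun p => (W p - X p + δ p.1) / max (Sl p) (Su p)) ?_ hc
    (eventually_probFilter_of_ae fun k => (H.critical k).mono fun ω => And.right)
  have hmax := H.tendsto_max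
  rw [← (H.degenerate d hδ).1, max_self] at hmax
  exact (H.tendsto_width_nhds hδ).div hmax H.σl_pos.ne'

/-- Outside the identified set, undercoverage by the two endpoints are nested events. -/
lemma measureReal_coverage (H : AsymptoticBounds Q α X W Sl Su C δ σl σu) (h : ℕ → ℝ) (k : ℕ) :
    (Q k).real {ω | X ⟨k, ω⟩ ≤ h k + Sl ⟨k, ω⟩ * C ⟨k, ω⟩ ∧
        h k - δ k - Su ⟨k, ω⟩ * C ⟨k, ω⟩ ≤ W ⟨k, ω⟩} =
      (Q k).real {ω | X ⟨k, ω⟩ ≤ h k + Sl ⟨k, ω⟩ * C ⟨k, ω⟩} -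
        (Q k).real {ω | W ⟨k, ω⟩ < h k - δ k - Su ⟨k, ω⟩ * C ⟨k, ω⟩} := by
  have hmeas : MeasurableSet {ω | W ⟨k, ω⟩ < h k - δ k - Su ⟨k, ω⟩ * C ⟨k, ω⟩} :=
    measurableSet_lt (H.measurable_W k)
      (measurable_const.sub ((H.measurable_Su k).mul (H.measurable_C k)))
  rw [← measureReal_inter_add_sdiff (s := {ω | X ⟨k, ω⟩ ≤ h k + Sl ⟨k, ω⟩ * C ⟨k, ω⟩}) hmeas]
  have hsub : (Q k).real ({ω | X ⟨k, ω⟩ ≤ h k + Sl ⟨k, ω⟩ * C ⟨k, ω⟩} ∩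
      {ω | W ⟨k, ω⟩ < h k - δ k - Su ⟨k, ω⟩ * C ⟨k, ω⟩}) =
      (Q k).real {ω | W ⟨k, ω⟩ < h k - δ k - Su ⟨k, ω⟩ * C ⟨k, ω⟩} := by
    refine measureReal_congr ?_
    filter_upwards [H.S_pos k, H.le k, H.critical k] with ω hS hle hC
    refine propext ⟨And.right, fun hW => ⟨?_, hW⟩⟩
    have h₁ := mul_pos hS.1 hC.1
    have h₂ := mul_pos hS.2 hC.1
    change W ⟨k, ω⟩ < h k - δ k - Su ⟨k, ω⟩ * C ⟨k, ω⟩ at hW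
    change X ⟨k, ω⟩ ≤ h k + Sl ⟨k, ω⟩ * C ⟨k, ω⟩
    linarith
  rw [hsub, add_sub_cancel_left]
  congr 1
  ext ω
  simp

lemma tendsto_coverage_of_atTop (H : AsymptoticBounds Q α X W Sl Su C δ σl σu) {h : ℕ → ℝ}
    {h₀ c : ℝ} (hh₀ : Tendsto h atTop (𝓝 h₀))
    (hδ : Tendsto δ atTop atTop) (hc : Phi c = 1 - α) :
    Tendsto (fun k => (Q k).real {ω | X ⟨k, ω⟩ ≤ h k + Sl ⟨k, ω⟩ * C ⟨k, ω⟩ ∧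
      h k - δ k - Su ⟨k, ω⟩ * C ⟨k, ω⟩ ≤ W ⟨k, ω⟩}) atTop (𝓝 (Phi (h₀ / σl + c))) := by
  have hC := H.tendsto_C_of_atTop hδ hc
  have hh' := hh₀.comp (tendsto_fst_probFilter (Q := Q))
  have hl := H.tendsto_measureReal_X_nhds (hh'.add (H.tendsto_Sl.mul hC))
  have hu : Tendsto (fun p : Σ k, Ω k => h p.1 - δ p.1 - Su p * C p) (probFilter Q) atBot := by
    refine ((hh'.sub (H.tendsto_Su.mul hC)).add_atBot
      (tendsto_neg_atTop_atBot.comp (hδ.comp tendsto_fst_probFilter))).congr fun p => ?_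
    simp only [Function.comp_apply]
    ring
  have hlim := hl.sub (H.tendsto_measureReal_W_atBot hu)
  rw [sub_zero, add_div, mul_div_cancel_left₀ _ H.σl_pos.ne'] at hlim
  exact hlim.congr fun k => (H.measureReal_coverage h k).symm

lemma tendsto_coverage_of_nhds (H : AsymptoticBounds Q α X W Sl Su C δ σl σu) {h : ℕ → ℝ}
    {h₀ d c : ℝ} (hh₀ : Tendsto h atTop (𝓝 h₀))
    (hδ : Tendsto δ atTop (𝓝 d)) (hc : Phi (c + d / σl) - Phi (-c) = 1 - α) :
    Tendsto (fun k => (Q k).real {ω | X ⟨k, ω⟩ ≤ h k + Sl ⟨k, ω⟩ * C ⟨k, ω⟩ ∧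
      h k - δ k - Su ⟨k, ω⟩ * C ⟨k, ω⟩ ≤ W ⟨k, ω⟩}) atTop
      (𝓝 (Phi (c - -h₀ / σl) + Phi (c + d / σl + -h₀ / σl) - 1)) := by
  have hC := H.tendsto_C_of_nhds hδ hc
  have hh' := hh₀.comp (tendsto_fst_probFilter (Q := Q))
  have hl := H.tendsto_measureReal_X_nhds (hh'.add (H.tendsto_Sl.mul hC))
  have hu := H.tendsto_measureReal_W_nhds
    ((hh'.sub (hδ.comp tendsto_fst_probFilter)).sub (H.tendsto_Su.mul hC))
  have hlim := hl.sub hu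
  have hσ := H.σl_pos.ne'
  rw [← (H.degenerate d hδ).1] at hlim
  have e₁ : (h₀ + σl * c) / σl = c - -h₀ / σl := by
    field_simp
    ring
  have e₂ : (h₀ - d - σl * c) / σl = -(c + d / σl + -h₀ / σl) := by
    field_simp
    ring
  rw [e₁, e₂, Phi_neg, ← sub_add, sub_add_eq_add_sub] at hlim
  exact hlim.congr fun k => (H.measureReal_coverage h k).symm

lemma tendsto_coverage_of_atBot (H : AsymptoticBounds Q α X W Sl Su C δ σl σu) {h : ℕ → ℝ}
    {c : ℝ} (hh₀ : Tendsto h atTop atBot) (hC : Tendsto C (probFilter Q) (𝓝 c)) :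
    Tendsto (fun k => (Q k).real {ω | X ⟨k, ω⟩ ≤ h k + Sl ⟨k, ω⟩ * C ⟨k, ω⟩ ∧
      h k - δ k - Su ⟨k, ω⟩ * C ⟨k, ω⟩ ≤ W ⟨k, ω⟩}) atTop (𝓝 0) := by
  have ha : Tendsto (fun p : Σ k, Ω k => h p.1 + Sl p * C p) (probFilter Q) atBot :=
    (hh₀.comp tendsto_fst_probFilter).atBot_add (H.tendsto_Sl.mul hC)
  exact squeeze_zero (fun k => measureReal_nonneg)
    (fun k => measureReal_mono fun ω hω => hω.1) (H.tendsto_measureReal_X_atBot ha)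

variable {X' W' Sl' Su' C' : (Σ k, Ω k) → ℝ} {σl' σu' : ℝ}

/-- Smaller limiting standard deviations do not increase asymptotic coverage outside the
identified set. -/
lemma eventually_coverage_lt (H : AsymptoticBounds Q α X W Sl Su C δ σl σu)
    (H' : AsymptoticBounds Q α X' W' Sl' Su' C' δ σl' σu') (hα : 0 < α) (hα' : α < 1 / 2)
    (hσ : σl ≤ σl') {h : ℕ → ℝ} (hh : ∀ k, h k ≤ 0)
    (hh₀ : (∃ h₀, Tendsto h atTop (𝓝 h₀)) ∨ Tendsto h atTop atBot) (hδ : ∀ k, 0 ≤ δ k)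
    (hδ₀ : (∃ d, Tendsto δ atTop (𝓝 d)) ∨ Tendsto δ atTop atTop) {ε : ℝ} (hε : 0 < ε) :
    ∀ᶠ k in atTop,
      (Q k).real {ω | X ⟨k, ω⟩ ≤ h k + Sl ⟨k, ω⟩ * C ⟨k, ω⟩ ∧
        h k - δ k - Su ⟨k, ω⟩ * C ⟨k, ω⟩ ≤ W ⟨k, ω⟩} -
      (Q k).real {ω | X' ⟨k, ω⟩ ≤ h k + Sl' ⟨k, ω⟩ * C' ⟨k, ω⟩ ∧
        h k - δ k - Su' ⟨k, ω⟩ * C' ⟨k, ω⟩ ≤ W' ⟨k, ω⟩} < ε := by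
  rcases hh₀ with ⟨h₀, hh₀⟩ | hh₀
  · have hh₀' : h₀ ≤ 0 := le_of_tendsto' hh₀ hh
    rcases hδ₀ with ⟨d, hd⟩ | hd
    · have hd' : 0 ≤ d := ge_of_tendsto' hd hδ
      obtain ⟨c, hc, hceq⟩ := exists_critical_value hα hα' (d / σl)
      obtain ⟨c', hc', hceq'⟩ := exists_critical_value hα hα' (d / σl')
      refine ((H.tendsto_coverage_of_nhds hh₀ hd hceq).sub
        (H'.tendsto_coverage_of_nhds hh₀ hd hceq')).eventually
        (gt_mem_nhds (lt_of_le_of_lt ?_ hε))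
      have hdσ : d / σl' ≤ d / σl := div_le_div_of_nonneg_left hd' H.σl_pos hσ
      obtain ⟨h₁, h₂⟩ := critical_value_antitone hdσ hceq' hceq
      have hmono := Phi_sub_add_Phi_add_le hc.le h₁
        (le_add_of_nonneg_right (div_nonneg hd' H'.σl_pos.le)) h₂
        (div_nonneg (neg_nonneg.2 hh₀') H'.σl_pos.le)
        (div_le_div_of_nonneg_left (neg_nonneg.2 hh₀') H.σl_pos hσ)
        (by rw [Phi_neg] at hceq hceq'; linarith)
      linarith
    · obtain ⟨c, -, hceq⟩ := exists_critical_value_top hα hα'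
      refine ((H.tendsto_coverage_of_atTop hh₀ hd hceq).sub
        (H'.tendsto_coverage_of_atTop hh₀ hd hceq)).eventually
        (gt_mem_nhds (lt_of_le_of_lt ?_ hε))
      have hdσ : -h₀ / σl' ≤ -h₀ / σl :=
        div_le_div_of_nonneg_left (neg_nonneg.2 hh₀') H.σl_pos hσ
      rw [neg_div, neg_div, neg_le_neg_iff] at hdσ
      exact sub_nonpos.2 (strictMono_Phi.monotone (by linarith))
  · have hC : ∃ c, Tendsto C (probFilter Q) (𝓝 c) := by
      rcases hδ₀ with ⟨d, hd⟩ | hd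
      · obtain ⟨c, -, hceq⟩ := exists_critical_value hα hα' (d / σl)
        exact ⟨c, H.tendsto_C_of_nhds hd hceq⟩
      · obtain ⟨c, -, hceq⟩ := exists_critical_value_top hα hα'
        exact ⟨c, H.tendsto_C_of_atTop hd hceq⟩
    obtain ⟨c, hC⟩ := hC
    filter_upwards [(H.tendsto_coverage_of_atBot hh₀ hC).eventually (gt_mem_nhds hε)] with k hk
    exact (sub_le_self _ measureReal_nonneg).trans_lt hk

end AsymptoticBounds

end ProbabilityFilter

section LimitLaw

lemma measurable_limitLaw_map (sl su r : ℝ) : Measurable fun z : ℝ × ℝ =>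
    (sl * z.1, su * (r * z.1 + Real.sqrt (1 - r ^ 2) * z.2)) := by
  fun_prop

instance isProbabilityMeasure_limitLaw (sl su r : ℝ) : IsProbabilityMeasure (limitLaw sl su r) :=
  Measure.isProbabilityMeasure_map (measurable_limitLaw_map sl su r).aemeasurable

lemma limitLaw_map_fst (sl su r : ℝ) :
    (limitLaw sl su r).map Prod.fst = (gaussianReal 0 1).map (sl * ·) := by
  have h : (gaussianReal 0 1).map (sl * ·) =
      (((gaussianReal 0 1).prod (gaussianReal 0 1)).map Prod.fst).map (sl * ·) := by
    simp [Measure.map_fst_prod]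
  rw [h, limitLaw, Measure.map_map measurable_fst (measurable_limitLaw_map sl su r),
    Measure.map_map (measurable_const_mul sl) measurable_fst]
  rfl

lemma gaussianReal_prod_map_rotation {r : ℝ} (hr : r ∈ Set.Icc (-1 : ℝ) 1) :
    ((gaussianReal 0 1).prod (gaussianReal 0 1)).map
      (fun z : ℝ × ℝ => r * z.1 + Real.sqrt (1 - r ^ 2) * z.2) = gaussianReal 0 1 := by
  have hr2 : 0 ≤ 1 - r ^ 2 := by nlinarith [hr.1, hr.2]
  have h := gaussianReal_conv_gaussianReal (m₁ := r * 0) (m₂ := Real.sqrt (1 - r ^ 2) * 0)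
    (v₁ := NNReal.mk (r ^ 2) (sq_nonneg _) * 1)
    (v₂ := NNReal.mk (Real.sqrt (1 - r ^ 2) ^ 2) (sq_nonneg _) * 1)
  rw [← gaussianReal_map_const_mul, ← gaussianReal_map_const_mul, Measure.conv,
    Measure.map_prod_map _ _ (by fun_prop) (by fun_prop),
    Measure.map_map (by fun_prop) (by fun_prop)] at h
  refine h.trans ?_
  congr 1
  · simp
  · ext
    simp [Real.sq_sqrt hr2]

lemma limitLaw_map_snd (sl su : ℝ) {r : ℝ} (hr : r ∈ Set.Icc (-1 : ℝ) 1) :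
    (limitLaw sl su r).map Prod.snd = (gaussianReal 0 1).map (su * ·) := by
  rw [limitLaw, Measure.map_map measurable_snd (measurable_limitLaw_map sl su r)]
  conv_rhs => rw [← gaussianReal_prod_map_rotation hr,
    Measure.map_map (measurable_const_mul su) (by fun_prop)]
  rfl

lemma gaussianReal_map_mul_singleton {s : ℝ} (hs : 0 < s) (x : ℝ) :
    (gaussianReal 0 1).map (s * ·) {x} = 0 := by
  rw [Measure.map_apply (measurable_const_mul s) (measurableSet_singleton x)]
  refine measure_mono_null (fun y hy => ?_) (gaussianReal_noAtoms (x / s))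
  rw [Set.mem_preimage, Set.mem_singleton_iff] at hy
  rw [Set.mem_singleton_iff, ← hy, mul_div_cancel_left₀ _ hs.ne']

lemma gaussianReal_map_mul_Iic {s : ℝ} (hs : 0 < s) (x : ℝ) :
    ((gaussianReal 0 1).map (s * ·)).real (Set.Iic x) = Phi (x / s) := by
  rw [map_measureReal_apply (measurable_const_mul s) measurableSet_Iic, Phi, measureReal_def]
  congr 2
  ext y
  simp [le_div_iff₀ hs, mul_comm]

lemma gaussianReal_map_mul_Iio {s : ℝ} (hs : 0 < s) (x : ℝ) :
    ((gaussianReal 0 1).map (s * ·)).real (Set.Iio x) = Phi (x / s) := by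
  rw [map_measureReal_apply (measurable_const_mul s) measurableSet_Iio,
    ← gaussianReal_Iio_toReal, measureReal_def]
  congr 2
  ext y
  simp [lt_div_iff₀ hs, mul_comm]

lemma limitLaw_parameters_of_measure_eq_zero {sl su r M : ℝ} (hsl : 0 < sl) (hsu : 0 < su)
    (hr : r ∈ Set.Icc (-1 : ℝ) 1) (h : limitLaw sl su r {p | M < p.1 - p.2} = 0) :
    sl = su ∧ r = 1 := by
  have hopen : IsOpen {p : ℝ × ℝ | M < p.1 - p.2} :=
    isOpen_lt continuous_const (continuous_fst.sub continuous_snd)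
  rw [limitLaw, Measure.map_apply (measurable_limitLaw_map sl su r) hopen.measurableSet] at h
  have hac : (volume : Measure (ℝ × ℝ)) ≪ (gaussianReal 0 1).prod (gaussianReal 0 1) :=
    (gaussianReal_absolutelyContinuous' 0 one_ne_zero).prod
      (gaussianReal_absolutelyContinuous' 0 one_ne_zero)
  have hempty := (hopen.preimage (by fun_prop :
    Continuous fun z : ℝ × ℝ => (sl * z.1, su * (r * z.1 + Real.sqrt (1 - r ^ 2) * z.2)))
    |>.measure_eq_zero_iff volume).1 (hac h)
  have hle (a b : ℝ) : (sl - su * r) * a - su * Real.sqrt (1 - r ^ 2) * b ≤ M := by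
    by_contra! hlt
    have : (a, b) ∈ (∅ : Set (ℝ × ℝ)) := by
      rw [← hempty]
      change M < sl * a - su * (r * a + Real.sqrt (1 - r ^ 2) * b)
      linarith
    exact this
  have hzero {q : ℝ} (hq : ∀ t, q * t ≤ M) : q = 0 := by
    by_contra hne
    have := hq ((M + 1) / q)
    rw [mul_div_cancel₀ _ hne] at this
    linarith
  have h₁ : sl - su * r = 0 := hzero fun t => by simpa using hle t 0
  have h₂ : su * Real.sqrt (1 - r ^ 2) = 0 := hzero fun t => by simpa using hle 0 (-t)
  have hrpos : 0 < r := by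
    by_contra! hle
    nlinarith
  have hsq : 1 - r ^ 2 ≤ 0 :=
    Real.sqrt_eq_zero'.1 ((mul_eq_zero.1 h₂).resolve_left hsu.ne')
  have hr1 : r = 1 := le_antisymm hr.2 (by nlinarith)
  subst hr1
  exact ⟨by linarith, rfl⟩

lemma limitLaw_one_diagonal (s : ℝ) : limitLaw s s 1 {p | p.1 ≠ p.2} = 0 := by
  have hopen : IsOpen {p : ℝ × ℝ | p.1 ≠ p.2} := isOpen_ne_fun continuous_fst continuous_snd
  rw [limitLaw, Measure.map_apply (measurable_limitLaw_map s s 1) hopen.measurableSet]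
  simp

end LimitLaw

section WeakLimit

variable {Ω : ℕ → Type} [∀ k, MeasurableSpace (Ω k)] {Q : ∀ k, Measure (Ω k)}
  [∀ k, IsProbabilityMeasure (Q k)]

/-- Convergence of the laws of random vectors, from convergence of integrals of bounded continuous
functions. -/
lemma tendsto_law_of_integral {Y : ∀ k, Ω k → ℝ × ℝ} (hY : ∀ k, Measurable (Y k))
    {ν : Measure (ℝ × ℝ)} [IsProbabilityMeasure ν]
    (h : ∀ g : BoundedContinuousFunction (ℝ × ℝ) ℝ,
      Tendsto (fun k => ∫ ω, g (Y k ω) ∂(Q k)) atTop (𝓝 (∫ x, g x ∂ν))) :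
    Tendsto (β := ProbabilityMeasure (ℝ × ℝ))
      (fun k => ⟨(Q k).map (Y k), Measure.isProbabilityMeasure_map (hY k).aemeasurable⟩) atTop
      (𝓝 ⟨ν, inferInstance⟩) := by
  refine ProbabilityMeasure.tendsto_iff_forall_integral_tendsto.2 fun g => ?_
  refine (h g).congr fun k => ?_
  exact (integral_map (hY k).aemeasurable g.continuous.aestronglyMeasurable).symm

lemma tendsto_measureReal_of_integral {Y : ∀ k, Ω k → ℝ × ℝ} (hY : ∀ k, Measurable (Y k))
    {ν : Measure (ℝ × ℝ)} [IsProbabilityMeasure ν]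
    (h : ∀ g : BoundedContinuousFunction (ℝ × ℝ) ℝ,
      Tendsto (fun k => ∫ ω, g (Y k ω) ∂(Q k)) atTop (𝓝 (∫ x, g x ∂ν)))
    {s : Set (ℝ × ℝ)} (hs : MeasurableSet s) (hν : ν (frontier s) = 0) :
    Tendsto (fun k => (Q k).real {ω | Y k ω ∈ s}) atTop (𝓝 (ν.real s)) := by
  have hlim := ProbabilityMeasure.tendsto_measure_of_null_frontier_of_tendsto'
    (tendsto_law_of_integral hY h) hν
  refine ((ENNReal.tendsto_toReal (measure_ne_top ν s)).comp hlim).congr fun k => ?_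
  simp only [Function.comp_apply, ProbabilityMeasure.coe_mk]
  rw [Measure.map_apply (hY k) hs]
  rfl

lemma tendsto_measureReal_comp_of_integral {Y : ∀ k, Ω k → ℝ × ℝ} (hY : ∀ k, Measurable (Y k))
    {ν : Measure (ℝ × ℝ)} [IsProbabilityMeasure ν]
    (h : ∀ g : BoundedContinuousFunction (ℝ × ℝ) ℝ,
      Tendsto (fun k => ∫ ω, g (Y k ω) ∂(Q k)) atTop (𝓝 (∫ x, g x ∂ν)))
    {f : ℝ × ℝ → ℝ} (hf : Continuous f) {s : Set ℝ} (hs : MeasurableSet s)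
    (hν : ν.map f (frontier s) = 0) :
    Tendsto (fun k => (Q k).real {ω | f (Y k ω) ∈ s}) atTop (𝓝 ((ν.map f).real s)) := by
  rw [map_measureReal_apply hf.measurable hs]
  refine tendsto_measureReal_of_integral hY h (hf.measurable hs)
    (measure_mono_null (hf.frontier_preimage_subset s) ?_)
  rwa [← Measure.map_apply hf.measurable isClosed_frontier.measurableSet]

variable {α : ℝ} {X W Sl Su C : (Σ k, Ω k) → ℝ} {δ : ℕ → ℝ} {sl su r : ℝ}

lemma AsymptoticBounds.of_limitLaw
    (hX : ∀ k, Measurable fun ω => X ⟨k, ω⟩) (hW : ∀ k, Measurable fun ω => W ⟨k, ω⟩)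
    (hSl : ∀ k, Measurable fun ω => Sl ⟨k, ω⟩) (hSu : ∀ k, Measurable fun ω => Su ⟨k, ω⟩)
    (hCm : ∀ k, Measurable fun ω => C ⟨k, ω⟩)
    (hsl : 0 < sl) (hsu : 0 < su) (hr : r ∈ Set.Icc (-1 : ℝ) 1)
    (hlaw : ∀ g : BoundedContinuousFunction (ℝ × ℝ) ℝ,
      Tendsto (fun k => ∫ ω, g (X ⟨k, ω⟩, W ⟨k, ω⟩) ∂(Q k)) atTop
        (𝓝 (∫ x, g x ∂(limitLaw sl su r))))
    (hS : ∀ ε : ℝ, 0 < ε → Tendsto (fun k =>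
      (Q k).real {ω | ε ≤ |Sl ⟨k, ω⟩ - sl| ∨ ε ≤ |Su ⟨k, ω⟩ - su|}) atTop (𝓝 0))
    (hSpos : ∀ k, ∀ᵐ ω ∂(Q k), 0 < Sl ⟨k, ω⟩ ∧ 0 < Su ⟨k, ω⟩)
    (hle : ∀ k, ∀ᵐ ω ∂(Q k), X ⟨k, ω⟩ ≤ W ⟨k, ω⟩ + δ k)
    (hC : ∀ k, ∀ᵐ ω ∂(Q k), 0 < C ⟨k, ω⟩ ∧
      Phi (C ⟨k, ω⟩ + (W ⟨k, ω⟩ - X ⟨k, ω⟩ + δ k) / max (Sl ⟨k, ω⟩) (Su ⟨k, ω⟩)) -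
        Phi (-C ⟨k, ω⟩) = 1 - α) :
    AsymptoticBounds Q α X W Sl Su C δ sl su where
  measurable_X := hX
  measurable_W := hW
  measurable_Sl := hSl
  measurable_Su := hSu
  measurable_C := hCm
  σl_pos := hsl
  σu_pos := hsu
  tendsto_X x := by
    have h := tendsto_measureReal_comp_of_integral (fun k => (hX k).prodMk (hW k)) hlaw
      continuous_fst (measurableSet_Iic (a := x))
      (by rw [frontier_Iic, limitLaw_map_fst, gaussianReal_map_mul_singleton hsl])
    rwa [limitLaw_map_fst, gaussianReal_map_mul_Iic hsl] at h
  tendsto_W x := by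
    have h := tendsto_measureReal_comp_of_integral (fun k => (hX k).prodMk (hW k)) hlaw
      continuous_snd (measurableSet_Iio (a := x))
      (by rw [frontier_Iio, limitLaw_map_snd sl su hr, gaussianReal_map_mul_singleton hsu])
    rwa [limitLaw_map_snd sl su hr, gaussianReal_map_mul_Iio hsu] at h
  tendsto_Sl := by
    refine Metric.tendsto_nhds.2 fun ε hε => eventually_probFilter.2 ?_
    refine squeeze_zero (fun k => measureReal_nonneg) (fun k => ?_) (hS ε hε)
    refine measureReal_mono fun ω hω => Or.inl ?_
    simpa [Real.dist_eq] using hω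
  tendsto_Su := by
    refine Metric.tendsto_nhds.2 fun ε hε => eventually_probFilter.2 ?_
    refine squeeze_zero (fun k => measureReal_nonneg) (fun k => ?_) (hS ε hε)
    refine measureReal_mono fun ω hω => Or.inr ?_
    simpa [Real.dist_eq] using hω
  S_pos := hSpos
  le := hle
  degenerate d hd := by
    have hY (k : ℕ) : Measurable fun ω => (X ⟨k, ω⟩, W ⟨k, ω⟩) := (hX k).prodMk (hW k)
    have hopen : IsOpen {p : ℝ × ℝ | d + 1 < p.1 - p.2} :=
      isOpen_lt continuous_const (continuous_fst.sub continuous_snd)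
    have hzero : limitLaw sl su r {p | d + 1 < p.1 - p.2} = 0 := by
      have hliminf := ProbabilityMeasure.le_liminf_measure_open_of_tendsto
        (tendsto_law_of_integral hY hlaw) hopen
      simp only [ProbabilityMeasure.coe_mk] at hliminf
      refine le_antisymm (hliminf.trans_eq ?_) zero_le
      refine (tendsto_const_nhds.congr' ?_).liminf_eq
      filter_upwards [hd.eventually (gt_mem_nhds (lt_add_one d))] with k hk
      rw [Measure.map_apply (hY k) hopen.measurableSet, eq_comm]
      refine measure_mono_null (fun ω hω => ?_) (ae_iff.1 (hle k))
      have hω : d + 1 < X ⟨k, ω⟩ - W ⟨k, ω⟩ := hω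
      simp only [Set.mem_ofPred_eq, not_le]
      linarith
    obtain ⟨heq, hr1⟩ := limitLaw_parameters_of_measure_eq_zero hsl hsu hr hzero
    refine ⟨heq, Metric.tendsto_nhds.2 fun ε hε => eventually_probFilter.2 ?_⟩
    subst hr1 heq
    have hclosed : IsClosed {p : ℝ × ℝ | ε ≤ |p.2 - p.1|} :=
      isClosed_le continuous_const (continuous_snd.sub continuous_fst).abs
    have hnull : limitLaw sl sl 1 {p | ε ≤ |p.2 - p.1|} = 0 := by
      refine measure_mono_null (fun p hp => ?_) (limitLaw_one_diagonal sl)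
      have hp : ε ≤ |p.2 - p.1| := hp
      change p.1 ≠ p.2
      intro heq
      rw [heq, sub_self, abs_zero] at hp
      exact hp.not_gt hε
    have h := tendsto_measureReal_of_integral hY hlaw hclosed.measurableSet
      (measure_mono_null hclosed.frontier_subset hnull)
    rw [measureReal_def, hnull, ENNReal.toReal_zero] at h
    refine h.congr fun k => ?_
    simp
  critical := hC

end WeakLimit

lemma EReal.tendsto_real_of_coe_le {x : ℕ → ℝ} {a : EReal} {b : ℝ} (hx : ∀ k, x k ≤ b)
    (h : Tendsto (fun k => (x k : EReal)) atTop (𝓝 a)) :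
    (∃ a', Tendsto x atTop (𝓝 a')) ∨ Tendsto x atTop atBot := by
  induction a with
  | bot => exact Or.inr (EReal.tendsto_coe_nhds_bot_iff.1 h)
  | coe a => exact Or.inl ⟨a, EReal.tendsto_coe.1 h⟩
  | top =>
    have := le_of_tendsto' h fun k => EReal.coe_le_coe_iff.2 (hx k)
    exact absurd this (by simp)

lemma exists_subseq_tendsto {E : Type*} [TopologicalSpace E] [FirstCountableTopology E]
    {K : Set E} (hK : IsCompact K) {x : ℕ → E} (hx : ∀ n, x n ∈ K) {δ h : ℕ → ℝ}
    (hδ : ∀ n, 0 ≤ δ n) (hh : ∀ n, h n ≤ 0) :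
    ∃ a ∈ K, ∃ φ : ℕ → ℕ, StrictMono φ ∧ Tendsto (x ∘ φ) atTop (𝓝 a) ∧
      ((∃ d, Tendsto (δ ∘ φ) atTop (𝓝 d)) ∨ Tendsto (δ ∘ φ) atTop atTop) ∧
      ((∃ h₀, Tendsto (h ∘ φ) atTop (𝓝 h₀)) ∨ Tendsto (h ∘ φ) atTop atBot) := by
  obtain ⟨⟨a, b, c⟩, ha, φ, hφ, hlim⟩ :=
    (hK.prod (isCompact_univ (X := EReal × EReal))).tendsto_subseq
      (x := fun n => (x n, ((-δ n : ℝ) : EReal), (h n : EReal)))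
      fun n => ⟨hx n, Set.mem_univ _⟩
  rw [nhds_prod_eq, nhds_prod_eq] at hlim
  have h₁ : Tendsto (x ∘ φ) atTop (𝓝 a) := tendsto_fst.comp hlim
  have h₂ : Tendsto (fun k => ((-δ (φ k) : ℝ) : EReal)) atTop (𝓝 b) :=
    (tendsto_fst.comp tendsto_snd).comp hlim
  have h₃ : Tendsto (fun k => ((h (φ k) : ℝ) : EReal)) atTop (𝓝 c) :=
    (tendsto_snd.comp tendsto_snd).comp hlim
  refine ⟨a, ha.1, φ, hφ, h₁, ?_,
    EReal.tendsto_real_of_coe_le (fun k => hh (φ k)) h₃⟩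
  refine (EReal.tendsto_real_of_coe_le (fun k => neg_nonpos.2 (hδ (φ k))) h₂).imp ?_ ?_
  · rintro ⟨d, hd⟩
    exact ⟨-d, by simpa [Function.comp_def] using hd.neg⟩
  · intro hd
    simpa [Function.comp_def] using tendsto_neg_atBot_atTop.comp hd

lemma rescaled_coverage_iff {l u sl su c tl tu t s : ℝ} (hs : 0 < s) :
    (l - sl * c / s ≤ t ∧ t ≤ u + su * c / s) ↔
      s * (l - tl) ≤ s * (t - tl) + sl * c ∧
        s * (t - tl) - s * (tu - tl) - su * c ≤ s * (u - tu) := by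
  have e₁ : l - sl * c / s = (s * l - sl * c) / s := by field_simp
  have e₂ : u + su * c / s = (s * u + su * c) / s := by field_simp
  rw [e₁, e₂, div_le_iff₀ hs, le_div_iff₀ hs]
  refine and_congr ?_ ?_ <;> constructor <;> intro h <;> linarith

/-- power comparison for `CI¹_α`.  The label `J : Bool` indexes the two
estimators, with `true` standing for the efficient label `E` and `false` for the
inefficient label `I`.  Under the ordered-bounds setup (ordering `Q_N(L ≤ U) = 1`,
uniform-subsequential asymptotic normality of the rescaled bound estimators with
limit law `(σ_l Z₁, σ_u(ρ Z₁ + √(1−ρ²) Z₂))`, consistency in probability of the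
standard-error estimators, variance bounds in `[σ̲, σ̄]`, `θ_u − θ_l ≤ Δ̄`), with the
efficient variances dominated by the inefficient ones, and `C^J_N` (a.s.) the unique
`c > 0` solving `Φ(c + √N(U − L)/max{S_l, S_u}) − Φ(−c) = 1 − α`, the coverage of the
interval `[L − S_l C/√N, U + S_u C/√N]` at points `θ_N ∉ [θ_{l,N}, θ_{u,N}]` satisfies
`liminf (Q_N(θ_N ∈ CI^E_N) − Q_N(θ_N ∈ CI^I_N)) ≤ 0`. -/
theorem power_comparison_CI1
    (α σlo σhi Δbar : ℝ)
    (hα : 0 < α) (hα' : α < 1 / 2) (hσlo : 0 < σlo) (hσ : σlo ≤ σhi)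
    (Ω : ℕ → Type) [∀ N, MeasurableSpace (Ω N)]
    (Q : ∀ N, Measure (Ω N)) [∀ N, IsProbabilityMeasure (Q N)]
    -- bound estimators, standard-error estimators, and critical values, for J ∈ {E, I}
    (L U Sl Su C : Bool → ∀ N : ℕ, Ω N → ℝ)
    (hmeas : ∀ J N, Measurable (L J N) ∧ Measurable (U J N) ∧ Measurable (Sl J N) ∧
      Measurable (Su J N) ∧ Measurable (C J N))
    -- population bounds and the parameter value under test
    (θl θu θ : ℕ → ℝ)
    (hθ : ∀ N, θl N ≤ θu N) (hΔ : ∀ N, θu N - θl N ≤ Δbar)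
    (hout : ∀ N, θ N ∉ Set.Icc (θl N) (θu N))
    -- asymptotic variance parameters
    (σl σu ρ : Bool → ℕ → ℝ)
    (hσl : ∀ J N, σl J N ∈ Set.Icc σlo σhi) (hσu : ∀ J N, σu J N ∈ Set.Icc σlo σhi)
    (hρ : ∀ J N, ρ J N ∈ Set.Icc (-1 : ℝ) 1)
    -- (i) ordering
    (hord : ∀ J N, Q N {ω | L J N ω ≤ U J N ω} = 1)
    -- the standard-error estimators are a.s. positive
    (hSpos : ∀ J N, ∀ᵐ ω ∂(Q N), 0 < Sl J N ω ∧ 0 < Su J N ω)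
    -- (ii) efficiency comparison: label `true` (E) has smaller variances than `false` (I)
    (heffl : ∀ N, σl true N ≤ σl false N)
    (heffu : ∀ N, σu true N ≤ σu false N)
    -- (iii) along every subsequence where the variance parameters converge, the rescaled
    -- bounds converge in distribution to the limit law and the standard-error
    -- estimators converge in probability to the limit variance parameters
    (hconv : ∀ J : Bool, ∀ φ : ℕ → ℕ, StrictMono φ → ∀ sl su r : ℝ,
      Tendsto (fun k => (σl J (φ k), σu J (φ k), ρ J (φ k))) atTop (nhds (sl, su, r)) →
      ((∀ g : BoundedContinuousFunction (ℝ × ℝ) ℝ,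
          Tendsto (fun k => ∫ ω, g (Real.sqrt (φ k) * (L J (φ k) ω - θl (φ k)),
              Real.sqrt (φ k) * (U J (φ k) ω - θu (φ k))) ∂(Q (φ k))) atTop
            (nhds (∫ x, g x ∂(limitLaw sl su r)))) ∧
        (∀ ε : ℝ, 0 < ε →
          Tendsto (fun k =>
              (Q (φ k) {ω | ε ≤ |Sl J (φ k) ω - sl| ∨ ε ≤ |Su J (φ k) ω - su|}).toReal)
            atTop (nhds 0))))
    -- `C J N` is (a.s.) the unique positive solution of Stoye's equation for `CI¹_α`
    (hC : ∀ J N, ∀ᵐ ω ∂(Q N), 0 < C J N ω ∧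
      Phi (C J N ω + Real.sqrt N * (U J N ω - L J N ω) / max (Sl J N ω) (Su J N ω)) -
        Phi (-(C J N ω)) = 1 - α) :
    liminf (fun N : ℕ =>
      (Q N {ω | L true N ω - Sl true N ω * C true N ω / Real.sqrt N ≤ θ N ∧
          θ N ≤ U true N ω + Su true N ω * C true N ω / Real.sqrt N}).toReal -
      (Q N {ω | L false N ω - Sl false N ω * C false N ω / Real.sqrt N ≤ θ N ∧
          θ N ≤ U false N ω + Su false N ω * C false N ω / Real.sqrt N}).toReal)
      atTop ≤ 0 := by
  set u : ℕ → ℝ := fun N : ℕ =>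
      (Q N {ω | L true N ω - Sl true N ω * C true N ω / Real.sqrt N ≤ θ N ∧
          θ N ≤ U true N ω + Su true N ω * C true N ω / Real.sqrt N}).toReal -
      (Q N {ω | L false N ω - Sl false N ω * C false N ω / Real.sqrt N ≤ θ N ∧
          θ N ≤ U false N ω + Su false N ω * C false N ω / Real.sqrt N}).toReal with hu
  by_contra! hpos
  obtain ⟨ε, hε, hεu⟩ := exists_between hpos
  have hbdd : IsBoundedUnder (· ≥ ·) atTop u :=
    isBoundedUnder_of ⟨-1, fun N => by
      have h₁ := measureReal_le_one (μ := Q N) (s := {ω | L false N ω - Sl false N ω *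
        C false N ω / Real.sqrt N ≤ θ N ∧
          θ N ≤ U false N ω + Su false N ω * C false N ω / Real.sqrt N})
      have h₂ := measureReal_nonneg (μ := Q N) (s := {ω | L true N ω - Sl true N ω *
        C true N ω / Real.sqrt N ≤ θ N ∧
          θ N ≤ U true N ω + Su true N ω * C true N ω / Real.sqrt N})
      rw [measureReal_def] at h₁ h₂
      simp only [hu]
      linarith⟩
  have hev := eventually_lt_of_lt_liminf hεu hbdd
  have hside (N : ℕ) : θ N < θl N ∨ θu N < θ N := by
    have := hout N
    rwa [Set.mem_Icc, not_and_or, not_le, not_le] at this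
  have hδ (N : ℕ) : 0 ≤ Real.sqrt N * (θu N - θl N) :=
    mul_nonneg (Real.sqrt_nonneg _) (sub_nonneg.2 (hθ N))
  have hh (N : ℕ) : Real.sqrt N * min (θ N - θl N) (θu N - θ N) ≤ 0 := by
    refine mul_nonpos_of_nonneg_of_nonpos (Real.sqrt_nonneg _) (min_le_iff.2 ?_)
    exact (hside N).imp (fun h => by linarith) (fun h => by linarith)
  have hK : IsCompact (Set.univ.pi fun _ : Bool =>
      Set.Icc σlo σhi ×ˢ Set.Icc σlo σhi ×ˢ Set.Icc (-1 : ℝ) 1) :=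
    isCompact_univ_pi fun _ => isCompact_Icc.prod (isCompact_Icc.prod isCompact_Icc)
  obtain ⟨a, ha, φ, hφ, hlim, hδlim, hhlim⟩ := exists_subseq_tendsto hK
    (x := fun N J => (σl J N, σu J N, ρ J N)) (fun N J _ => ⟨hσl J N, hσu J N, hρ J N⟩) hδ hh
  have hlimJ (J : Bool) :
      Tendsto (fun k => (σl J (φ k), σu J (φ k), ρ J (φ k))) atTop (𝓝 (a J)) :=
    tendsto_pi_nhds.1 hlim J
  have H (J : Bool) : AsymptoticBounds (fun k => Q (φ k)) α
      (fun p => Real.sqrt (φ p.1) * (L J (φ p.1) p.2 - θl (φ p.1)))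
      (fun p => Real.sqrt (φ p.1) * (U J (φ p.1) p.2 - θu (φ p.1)))
      (fun p => Sl J (φ p.1) p.2) (fun p => Su J (φ p.1) p.2) (fun p => C J (φ p.1) p.2)
      (fun k => Real.sqrt (φ k) * (θu (φ k) - θl (φ k))) (a J).1 (a J).2.1 := by
    have haJ := ha J (Set.mem_univ J)
    obtain ⟨hlaw, hS⟩ := hconv J φ hφ _ _ _ (hlimJ J)
    refine AsymptoticBounds.of_limitLaw
      (fun k => ((hmeas J (φ k)).1.sub_const (θl (φ k))).const_mul (Real.sqrt (φ k)))
      (fun k => ((hmeas J (φ k)).2.1.sub_const (θu (φ k))).const_mul (Real.sqrt (φ k)))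
      (fun k => (hmeas J (φ k)).2.2.1) (fun k => (hmeas J (φ k)).2.2.2.1)
      (fun k => (hmeas J (φ k)).2.2.2.2)
      (hσlo.trans_le haJ.1.1) (hσlo.trans_le haJ.2.1.1) haJ.2.2 hlaw hS
      (fun k => hSpos J (φ k)) (fun k => ?_) (fun k => ?_)
    · have hae : ∀ᵐ ω ∂(Q (φ k)), L J (φ k) ω ≤ U J (φ k) ω :=
        (mem_ae_iff_prob_eq_one (measurableSet_le (hmeas J (φ k)).1 (hmeas J (φ k)).2.1)).2
          (hord J (φ k))
      filter_upwards [hae] with ω hω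
      rw [← mul_add]
      exact mul_le_mul_of_nonneg_left (by linarith) (Real.sqrt_nonneg _)
    · filter_upwards [hC J (φ k)] with ω hω
      refine ⟨hω.1, ?_⟩
      rw [← hω.2]
      ring_nf
  have hal : (a true).1 ≤ (a false).1 :=
    le_of_tendsto_of_tendsto' ((continuous_fst.tendsto _).comp (hlimJ true))
      ((continuous_fst.tendsto _).comp (hlimJ false)) fun k => heffl (φ k)
  have hau : (a true).2.1 ≤ (a false).2.1 :=
    le_of_tendsto_of_tendsto' (((continuous_fst.comp continuous_snd).tendsto _).comp (hlimJ true))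
      (((continuous_fst.comp continuous_snd).tendsto _).comp (hlimJ false)) fun k => heffu (φ k)
  have hlow := (H true).eventually_coverage_lt (H false) hα hα' hal (fun k => hh (φ k)) hhlim
    (fun k => hδ (φ k)) hδlim hε
  have hupp := (H true).reflect.eventually_coverage_lt (H false).reflect hα hα' hau
    (fun k => hh (φ k)) hhlim (fun k => hδ (φ k)) hδlim hε
  obtain ⟨k, hk, hk₁, hk₂, hkpos⟩ := ((hφ.tendsto_atTop.eventually hev).and
    (hlow.and (hupp.and (hφ.tendsto_atTop.eventually (eventually_gt_atTop 0))))).exists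
  have hs : 0 < Real.sqrt (φ k) := Real.sqrt_pos.2 (Nat.cast_pos.2 hkpos)
  refine hk.not_gt ?_
  simp only [hu, rescaled_coverage_iff (tl := θl (φ k)) (tu := θu (φ k)) hs]
  rcases hside (φ k) with hlt | hlt
  · rwa [min_eq_left (by linarith [hθ (φ k)])] at hk₁
  · rw [min_eq_right (by linarith [hθ (φ k)])] at hk₂
    refine lt_of_eq_of_lt ?_ hk₂
    have hset (J : Bool) : {ω | Real.sqrt (φ k) * (L J (φ k) ω - θl (φ k)) ≤
          Real.sqrt (φ k) * (θ (φ k) - θl (φ k)) + Sl J (φ k) ω * C J (φ k) ω ∧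
        Real.sqrt (φ k) * (θ (φ k) - θl (φ k)) - Real.sqrt (φ k) * (θu (φ k) - θl (φ k)) -
          Su J (φ k) ω * C J (φ k) ω ≤ Real.sqrt (φ k) * (U J (φ k) ω - θu (φ k))} =
        {ω | -(Real.sqrt (φ k) * (U J (φ k) ω - θu (φ k))) ≤
          Real.sqrt (φ k) * (θu (φ k) - θ (φ k)) + Su J (φ k) ω * C J (φ k) ω ∧
        Real.sqrt (φ k) * (θu (φ k) - θ (φ k)) - Real.sqrt (φ k) * (θu (φ k) - θl (φ k)) -
          Sl J (φ k) ω * C J (φ k) ω ≤ -(Real.sqrt (φ k) * (L J (φ k) ω - θl (φ k)))} := by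
      ext ω
      simp only [Set.mem_ofPred_eq]
      refine and_comm.trans (and_congr ?_ ?_) <;> constructor <;> intro h <;> linarith
    rw [hset true, hset false]
    rfl
end

section
/- Let 0 < σ̲ ≤ σ̄ < ∞. For each N ≥ 1 let (Ω_N, Q_N) be a probability space carrying real random variables L_N and U_N with Q_N(L_N ≤ U_N) = 1, and let θ_{l,N} ≤ θ_{u,N} be real parameters. Suppose that √N(θ_{u,N} − θ_{l,N}) → μ for some μ ∈ [0, ∞), that (ρ_N, σ_{l,N}, σ_{u,N}) → (ρ, σ_l, σ_u) with ρ ∈ [−1, 1] and σ_l, σ_u ∈ [σ̲, σ̄], and that the random vector √N·(L_N − θ_{l,N}, U_N − θ_{u,N}) converges in distribution to (σ_l Z₁, σ_u(ρ Z₁ + √(1−ρ²) Z₂)), where Z₁, Z₂ are independent standard normal random variables. Then ρ = 1 and σ_l = σ_u. -/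
open MeasureTheory ProbabilityTheory Filter

instance gaussianReal.instIsOpenPosMeasure (m : ℝ) {v : NNReal} [NeZero v] :
    (gaussianReal m v).IsOpenPosMeasure :=
  (gaussianReal_absolutelyContinuous' m (NeZero.ne v)).isOpenPosMeasure

/-- The truncated excess `min 1 (max 0 (x - y - c))` as a bounded continuous function. -/
noncomputable def truncatedExcess (c : ℝ) : BoundedContinuousFunction (ℝ × ℝ) ℝ :=
  BoundedContinuousFunction.ofNormedAddCommGroup
    (fun p : ℝ × ℝ => min 1 (max 0 (p.1 - p.2 - c))) (by fun_prop) 1 (fun p => by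
      rw [Real.norm_eq_abs, abs_of_nonneg (le_min zero_le_one (le_max_left _ _))]
      exact min_le_left _ _)

lemma truncatedExcess_apply (c : ℝ) (p : ℝ × ℝ) :
    truncatedExcess c p = min 1 (max 0 (p.1 - p.2 - c)) := rfl

lemma truncatedExcess_nonneg (c : ℝ) (p : ℝ × ℝ) : 0 ≤ truncatedExcess c p :=
  le_min zero_le_one (le_max_left _ _)

lemma truncatedExcess_eq_zero_iff (c : ℝ) (p : ℝ × ℝ) :
    truncatedExcess c p = 0 ↔ p.1 - p.2 ≤ c := by
  rw [truncatedExcess_apply]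
  grind

/-- If the truncated excess integrates to zero under the limit law, then the difference of the
two coordinates is bounded above on the whole support. -/
lemma forall_sub_le_of_integral_truncatedExcess_eq_zero {sl su r c : ℝ}
    (h : ∫ x, truncatedExcess c x ∂(limitLaw sl su r) = 0) (z : ℝ × ℝ) :
    sl * z.1 - su * (r * z.1 + Real.sqrt (1 - r ^ 2) * z.2) ≤ c := by
  let T : ℝ × ℝ → ℝ × ℝ :=
    fun z => (sl * z.1, su * (r * z.1 + Real.sqrt (1 - r ^ 2) * z.2))
  have hT : Continuous T := by fun_prop
  have hgT : Continuous (fun z => truncatedExcess c (T z)) :=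
    (truncatedExcess c).continuous.comp hT
  have hmap : ∫ x, truncatedExcess c x ∂(limitLaw sl su r) =
      ∫ z, truncatedExcess c (T z) ∂((gaussianReal 0 1).prod (gaussianReal 0 1)) :=
    integral_map hT.aemeasurable (truncatedExcess c).continuous.aestronglyMeasurable
  have hint : Integrable (fun z => truncatedExcess c (T z))
      ((gaussianReal 0 1).prod (gaussianReal 0 1)) :=
    ((truncatedExcess c).compContinuous ⟨T, hT⟩).integrable _
  have hae := (integral_eq_zero_iff_of_nonneg
    (fun z => truncatedExcess_nonneg c (T z)) hint).1 (hmap.symm.trans h)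
  have hzero := (Continuous.ae_eq_iff_eq _ hgT continuous_zero).1 hae
  exact (truncatedExcess_eq_zero_iff c (T z)).1 (congrFun hzero z)

/-- A linear form on the line that is bounded above vanishes. -/
lemma eq_zero_of_forall_mul_le {a c : ℝ} (h : ∀ x : ℝ, a * x ≤ c) : a = 0 := by
  by_contra ha
  have := h ((c + 1) / a)
  rw [mul_div_cancel₀ _ ha] at this
  linarith

/-- Lemma on near-point-identification: if `Q_N(L_N ≤ U_N) = 1`,
`√N(θ_{u,N} − θ_{l,N}) → μ ∈ [0, ∞)`, `(ρ_N, σ_{l,N}, σ_{u,N}) → (ρ, σ_l, σ_u)` with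
`ρ ∈ [−1, 1]`, `σ_l, σ_u ∈ [σ̲, σ̄]`, and `√N (L_N − θ_{l,N}, U_N − θ_{u,N})` converges
in distribution to `(σ_l Z₁, σ_u(ρ Z₁ + √(1−ρ²) Z₂))`, then `ρ = 1` and `σ_l = σ_u`. -/
theorem near_point_identified_limit
    (σlo σhi : ℝ) (hσlo : 0 < σlo) (hσ : σlo ≤ σhi)
    (Ω : ℕ → Type) [∀ N, MeasurableSpace (Ω N)]
    (Q : ∀ N, Measure (Ω N)) [∀ N, IsProbabilityMeasure (Q N)]
    (L U : ∀ N : ℕ, Ω N → ℝ)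
    (hmeas : ∀ N, Measurable (L N) ∧ Measurable (U N))
    (θl θu : ℕ → ℝ) (hθ : ∀ N, θl N ≤ θu N)
    (hord : ∀ N, Q N {ω | L N ω ≤ U N ω} = 1)
    (μ : ℝ) (hμ : 0 ≤ μ)
    (hμconv : Tendsto (fun N : ℕ => Real.sqrt N * (θu N - θl N)) atTop (nhds μ))
    (ρseq σlseq σuseq : ℕ → ℝ) (ρ sl su : ℝ)
    (hρ : ρ ∈ Set.Icc (-1 : ℝ) 1)
    (hsl : sl ∈ Set.Icc σlo σhi) (hsu : su ∈ Set.Icc σlo σhi)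
    (hparam : Tendsto (fun N => (ρseq N, σlseq N, σuseq N)) atTop (nhds (ρ, sl, su)))
    (hdist : ∀ g : BoundedContinuousFunction (ℝ × ℝ) ℝ,
      Tendsto
        (fun N : ℕ => ∫ ω, g (Real.sqrt N * (L N ω - θl N), Real.sqrt N * (U N ω - θu N)) ∂(Q N))
        atTop (nhds (∫ x, g x ∂(limitLaw sl su ρ)))) :
    ρ = 1 ∧ sl = su := by
  have hbound : ∀ᶠ N : ℕ in atTop, Real.sqrt N * (θu N - θl N) < μ + 1 :=
    hμconv.eventually_lt_const (lt_add_one μ)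
  have hvanish : ∀ᶠ N : ℕ in atTop,
      ∫ ω, truncatedExcess (μ + 1)
        (Real.sqrt N * (L N ω - θl N), Real.sqrt N * (U N ω - θu N)) ∂(Q N) = 0 := by
    filter_upwards [hbound] with N hN
    have hle : ∀ᵐ ω ∂(Q N), L N ω ≤ U N ω :=
      (prob_compl_eq_zero_iff (measurableSet_le (hmeas N).1 (hmeas N).2)).2 (hord N)
    refine integral_eq_zero_of_ae ?_
    filter_upwards [hle] with ω hω
    refine (truncatedExcess_eq_zero_iff _ _).2 ?_
    have := mul_le_mul_of_nonneg_left hω (Real.sqrt_nonneg N)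
    dsimp only
    linarith
  have hlim : ∫ x, truncatedExcess (μ + 1) x ∂(limitLaw sl su ρ) = 0 :=
    tendsto_nhds_unique (hdist _) (tendsto_const_nhds.congr' (hvanish.mono fun _ h => h.symm))
  have hsub := forall_sub_le_of_integral_truncatedExcess_eq_zero hlim
  have hfst : sl - su * ρ = 0 := eq_zero_of_forall_mul_le (c := μ + 1) fun x => by
    have := hsub (x, 0)
    dsimp only at this
    linarith
  have hsnd : su * Real.sqrt (1 - ρ ^ 2) = 0 := eq_zero_of_forall_mul_le (c := μ + 1) fun x => by
    have := hsub (0, -x)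
    dsimp only at this
    linarith
  have hsl_pos : 0 < sl := hσlo.trans_le hsl.1
  have hsu_pos : 0 < su := hσlo.trans_le hsu.1
  have hsqrt : Real.sqrt (1 - ρ ^ 2) = 0 := (mul_eq_zero.1 hsnd).resolve_left hsu_pos.ne'
  have hρ_sq : 1 ≤ ρ ^ 2 := by linarith [Real.sqrt_eq_zero'.1 hsqrt]
  have hρ_pos : 0 < ρ := pos_of_mul_pos_right (by linarith : 0 < su * ρ) hsu_pos.le
  have hρ_one : ρ = 1 := le_antisymm hρ.2 (by nlinarith)
  refine ⟨hρ_one, ?_⟩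
  rw [hρ_one] at hfst
  linarith
end
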